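/- Let $f\in L_p(\mathbb{T})$, $1\le p<\infty$, $r,n\in\mathbb{N}$, and suppose the sampling operators $G_n$ satisfy conditions (c1), (c1'), (c2') for some $s\in\mathbb{N}$ with $s\le 2r$, and condition (c4). If in addition $G_\nu(f)\in\mathcal{T}_\nu$ for every $\nu\in\mathbb{N}$, then (with the convention $G_0(f):=0$) there exists a constant $C>0$ independent of $f$ and $n$ such that $\|f_{\gamma/n,\,r}-f\|_{\ell_p(X_n)}+\omega_s(f,1/n)_p\le C\Big(\|f-G_n(f)\|_p+\frac1{n^s}\sum_{\nu=0}^{n}(\nu+1)^{s-1}\|f-G_\nu(f)\|_p\Big)$. -/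

import Mathlib

open MeasureTheory Filter Finset

noncomputable def LpNorm (p : ℝ) (f : ℝ → ℝ) : ℝ :=
  (∫ x in (0:ℝ)..1, |f x| ^ p) ^ (1 / p)

def MemLpT (p : ℝ) (f : ℝ → ℝ) : Prop :=
  Function.Periodic f 1 ∧ Measurable f ∧
    IntervalIntegrable (fun x => |f x| ^ p) MeasureTheory.volume 0 1

noncomputable def Delta (r : ℕ) (h : ℝ) (f : ℝ → ℝ) (x : ℝ) : ℝ :=
  ∑ ν ∈ Finset.range (r + 1), ((-1 : ℝ) ^ ν * (r.choose ν : ℝ)) * f (x + ((r : ℝ) - (ν : ℝ)) * h)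

noncomputable def omegaMod (r : ℕ) (p : ℝ) (f : ℝ → ℝ) (δ : ℝ) : ℝ :=
  sSup {y | ∃ h : ℝ, 0 < h ∧ h < δ ∧ y = LpNorm p (Delta r h f)}

noncomputable def steklov (r : ℕ) (δ : ℝ) (f : ℝ → ℝ) (x : ℝ) : ℝ :=
  (-1 : ℝ) ^ (r + 1) * (((2 * r).choose r : ℝ))⁻¹ * (2 / δ) *
    ∫ t in (-(δ / 2))..(δ / 2),
      ∑ ν ∈ Finset.range r,
        (-1 : ℝ) ^ ν * (((2 * r).choose ν : ℝ)) * f (x + (((r : ℝ) - (ν : ℝ)) / (r : ℝ)) * t)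

noncomputable def ellp (p : ℝ) (n : ℕ) (x : ℕ → ℝ) (f : ℝ → ℝ) : ℝ :=
  ((1 / (n : ℝ)) * ∑ k ∈ Finset.range n, |f (x k)| ^ p) ^ (1 / p)

def SobolevW (s : ℕ) (g : ℝ → ℝ) : Prop :=
  Function.Periodic g 1 ∧ ContDiff ℝ (s : ℕ∞) g

noncomputable def localMod (r : ℕ) (f : ℝ → ℝ) (x δ : ℝ) : ℝ :=
  sSup {y | ∃ t h : ℝ, t ∈ Set.Icc (x - r * δ / 2) (x + r * δ / 2) ∧
    (t + r * h) ∈ Set.Icc (x - r * δ / 2) (x + r * δ / 2) ∧ y = |Delta r h f t|}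

noncomputable def tauMod (r : ℕ) (p : ℝ) (f : ℝ → ℝ) (δ : ℝ) : ℝ :=
  (∫ x in (0:ℝ)..1, localMod r f x δ ^ p) ^ (1 / p)

def IsTrigPoly (n : ℕ) (T : ℝ → ℝ) : Prop :=
  ∃ c : ℤ → ℂ, ∀ x : ℝ, (T x : ℂ) =
    ∑ ℓ ∈ Finset.Icc (-(n : ℤ)) (n : ℤ),
      c ℓ * Complex.exp (2 * Real.pi * Complex.I * (ℓ : ℂ) * (x : ℂ))

noncomputable def tildeE (n : ℕ) (p : ℝ) (f : ℝ → ℝ) : ℝ :=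
  sInf {y | ∃ Q q : ℝ → ℝ, IsTrigPoly n Q ∧ IsTrigPoly n q ∧
    (∀ x, q x ≤ f x ∧ f x ≤ Q x) ∧ y = LpNorm p (fun x => Q x - q x)}

noncomputable def dirichlet (n : ℕ) (x : ℝ) : ℝ :=
  ∑ ℓ ∈ Finset.Icc (-(n : ℤ)) (n : ℤ), Real.cos (2 * Real.pi * (ℓ : ℝ) * x)

noncomputable def lagrange (n : ℕ) (f : ℝ → ℝ) (x : ℝ) : ℝ :=
  (1 / (2 * (n : ℝ) + 1)) * ∑ k ∈ Finset.range (2 * n + 1),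
    f ((k : ℝ) / (2 * (n : ℝ) + 1)) * dirichlet n (x - (k : ℝ) / (2 * (n : ℝ) + 1))

def NodesOK (γ : ℝ) (X : ℕ → ℕ → ℝ) : Prop :=
  ∀ n : ℕ, 1 ≤ n →
    (0 ≤ X n 0) ∧ (∀ k, k + 1 < n → X n k < X n (k + 1)) ∧ (X n (n - 1) < 1) ∧
    (∀ k, k + 1 < n → γ / (n : ℝ) ≤ X n (k + 1) - X n k) ∧
    (γ / (n : ℝ) ≤ 1 + X n 0 - X n (n - 1))

def NodesOrd (X : ℕ → ℕ → ℝ) : Prop :=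
  ∀ n : ℕ, 1 ≤ n →
    (0 ≤ X n 0) ∧ (∀ k, k + 1 < n → X n k < X n (k + 1)) ∧ (X n (n - 1) < 1)

def SamplingForm (p : ℝ) (X : ℕ → ℕ → ℝ) (φ : ℕ → ℕ → ℝ → ℝ)
    (G : ℕ → (ℝ → ℝ) → ℝ → ℝ) : Prop :=
  (∀ n k, MemLpT p (φ n k)) ∧
  ∀ (n : ℕ) (f : ℝ → ℝ) (x : ℝ), G n f x = ∑ k ∈ Finset.range n, f (X n k) * φ n k x

def CondC1 (p K1 : ℝ) (X : ℕ → ℕ → ℝ) (G : ℕ → (ℝ → ℝ) → ℝ → ℝ) : Prop :=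
  ∀ f : ℝ → ℝ, MemLpT p f → ∀ n : ℕ, 1 ≤ n → LpNorm p (G n f) ≤ K1 * ellp p n (X n) f

def CondC1' (p K2 : ℝ) (X : ℕ → ℕ → ℝ) (G : ℕ → (ℝ → ℝ) → ℝ → ℝ) : Prop :=
  ∀ f : ℝ → ℝ, MemLpT p f → ∀ n : ℕ, 1 ≤ n → K2 * ellp p n (X n) f ≤ LpNorm p (G n f)

def CondC2' (p K3 : ℝ) (s : ℕ) (G : ℕ → (ℝ → ℝ) → ℝ → ℝ) : Prop :=
  ∀ g : ℝ → ℝ, SobolevW s g → ∀ n : ℕ, 1 ≤ n →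
    LpNorm p (fun x => g x - G n g x) ≤ K3 / (n : ℝ) ^ s * LpNorm p (iteratedDeriv s g)

def CondC3 (p K5 : ℝ) (s : ℕ) (G : ℕ → (ℝ → ℝ) → ℝ → ℝ) : Prop :=
  ∀ f : ℝ → ℝ, MemLpT p f → ∀ n : ℕ, 1 ≤ n →
    SobolevW s (G n f) ∧
    (1 / (n : ℝ) ^ s) * LpNorm p (iteratedDeriv s (G n f)) ≤
      K5 * omegaMod s p (G n f) (1 / (n : ℝ))

noncomputable def Gprev (G : ℕ → (ℝ → ℝ) → ℝ → ℝ) (f : ℝ → ℝ) (ν : ℕ) : ℝ → ℝ :=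
  if ν = 0 then fun _ => 0 else G (2 ^ (ν - 1)) f

def CondC4 (p K4 : ℝ) (s : ℕ) (G : ℕ → (ℝ → ℝ) → ℝ → ℝ) (f : ℝ → ℝ) : Prop :=
  ∀ ν : ℕ,
    SobolevW s (fun x => G (2 ^ ν) f x - Gprev G f ν x) ∧
    LpNorm p (iteratedDeriv s (fun x => G (2 ^ ν) f x - Gprev G f ν x)) ≤
      K4 * 2 ^ (s * ν) * LpNorm p (fun x => G (2 ^ ν) f x - Gprev G f ν x)

noncomputable def Kfun (s : ℕ) (p : ℝ) (n : ℕ) (x : ℕ → ℝ) (f : ℝ → ℝ) : ℝ :=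
  sInf {y | ∃ g : ℝ → ℝ, SobolevW s g ∧
    y = ellp p n x (fun t => f t - g t) + LpNorm p (fun t => f t - g t) +
        (1 / (n : ℝ) ^ s) * LpNorm p (iteratedDeriv s g)}


/-! ### Norm layer -/

lemma LpNorm_nonneg' (p : ℝ) (f : ℝ → ℝ) : 0 ≤ LpNorm p f := by
  unfold LpNorm
  apply Real.rpow_nonneg
  apply intervalIntegral.integral_nonneg zero_le_one
  intro x _
  positivity

lemma memLp_of_memLpT {p : ℝ} (hp : 1 ≤ p) {f : ℝ → ℝ} (hf : MemLpT p f) :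
    MemLp f (ENNReal.ofReal p) (volume.restrict (Set.Ioc (0:ℝ) 1)) := by
  have h0 : ENNReal.ofReal p ≠ 0 := by simp; linarith
  have h1 := (integrable_norm_rpow_iff (μ := volume.restrict (Set.Ioc (0:ℝ) 1))
    hf.2.1.aestronglyMeasurable h0 ENNReal.ofReal_ne_top).1
  apply h1
  have h2 := hf.2.2
  rw [intervalIntegrable_iff_integrableOn_Ioc_of_le zero_le_one] at h2
  rw [ENNReal.toReal_ofReal (by linarith)]
  exact h2

lemma memLpT_of_memLp {p : ℝ} (hp : 1 ≤ p) {f : ℝ → ℝ} (hper : Function.Periodic f 1)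
    (hm : Measurable f)
    (hf : MemLp f (ENNReal.ofReal p) (volume.restrict (Set.Ioc (0:ℝ) 1))) : MemLpT p f := by
  refine ⟨hper, hm, ?_⟩
  rw [intervalIntegrable_iff_integrableOn_Ioc_of_le zero_le_one]
  have := hf.integrable_norm_rpow (by simp; linarith) ENNReal.ofReal_ne_top
  rw [ENNReal.toReal_ofReal (by linarith)] at this
  exact this

lemma LpNorm_eq {p : ℝ} (hp : 1 ≤ p) {f : ℝ → ℝ} (hf : MemLpT p f) :
    LpNorm p f = (eLpNorm f (ENNReal.ofReal p) (volume.restrict (Set.Ioc (0:ℝ) 1))).toReal := by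
  rw [(memLp_of_memLpT hp hf).eLpNorm_eq_integral_rpow_norm (by simp; linarith)
    ENNReal.ofReal_ne_top, ENNReal.toReal_ofReal, ENNReal.toReal_ofReal (by linarith)]
  · unfold LpNorm
    rw [intervalIntegral.integral_of_le zero_le_one, one_div]
    rfl
  · apply Real.rpow_nonneg
    apply integral_nonneg
    intro x
    positivity

lemma MemLpT.add {p : ℝ} (hp : 1 ≤ p) {f g : ℝ → ℝ} (hf : MemLpT p f) (hg : MemLpT p g) :
    MemLpT p (fun x => f x + g x) :=
  memLpT_of_memLp hp (fun x => by simp [hf.1 x, hg.1 x]) (hf.2.1.add hg.2.1)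
    ((memLp_of_memLpT hp hf).add (memLp_of_memLpT hp hg))

lemma MemLpT.cmul {p : ℝ} (hp : 1 ≤ p) {f : ℝ → ℝ} (c : ℝ) (hf : MemLpT p f) :
    MemLpT p (fun x => c * f x) :=
  memLpT_of_memLp hp (fun x => by simp [hf.1 x]) (hf.2.1.const_mul c)
    ((memLp_of_memLpT hp hf).const_mul c)

lemma MemLpT.sub {p : ℝ} (hp : 1 ≤ p) {f g : ℝ → ℝ} (hf : MemLpT p f) (hg : MemLpT p g) :
    MemLpT p (fun x => f x - g x) :=
  memLpT_of_memLp hp (fun x => by simp [hf.1 x, hg.1 x]) (hf.2.1.sub hg.2.1)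
    ((memLp_of_memLpT hp hf).sub (memLp_of_memLpT hp hg))

lemma LpNorm_add_le' {p : ℝ} (hp : 1 ≤ p) {f g : ℝ → ℝ} (hf : MemLpT p f) (hg : MemLpT p g) :
    LpNorm p (fun x => f x + g x) ≤ LpNorm p f + LpNorm p g := by
  rw [LpNorm_eq hp hf, LpNorm_eq hp hg, LpNorm_eq hp (hf.add hp hg)]
  have h1 := memLp_of_memLpT hp hf
  have h2 := memLp_of_memLpT hp hg
  rw [← ENNReal.toReal_add h1.2.ne h2.2.ne]
  apply ENNReal.toReal_mono (ENNReal.add_ne_top.2 ⟨h1.2.ne, h2.2.ne⟩)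
  exact eLpNorm_add_le h1.1 h2.1 (by simpa using ENNReal.ofReal_le_ofReal hp)

lemma LpNorm_cmul {p : ℝ} (hp : 1 ≤ p) {f : ℝ → ℝ} (c : ℝ) (hf : MemLpT p f) :
    LpNorm p (fun x => c * f x) = |c| * LpNorm p f := by
  rw [LpNorm_eq hp hf, LpNorm_eq hp (hf.cmul hp c)]
  have := eLpNorm_const_smul c f (ENNReal.ofReal p) (volume.restrict (Set.Ioc (0:ℝ) 1))
  have h : (c • f) = fun x => c * f x := rfl
  rw [h] at this
  rw [this, ENNReal.toReal_mul]
  simp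

lemma LpNorm_sub_le' {p : ℝ} (hp : 1 ≤ p) {f g : ℝ → ℝ} (hf : MemLpT p f) (hg : MemLpT p g) :
    LpNorm p (fun x => f x - g x) ≤ LpNorm p f + LpNorm p g := by
  have h := LpNorm_add_le' hp hf (hg.cmul hp (-1))
  rw [LpNorm_cmul hp _ hg] at h
  simpa [sub_eq_add_neg] using h

lemma LpNorm_sub_comm' {p : ℝ} (f g : ℝ → ℝ) :
    LpNorm p (fun x => f x - g x) = LpNorm p (fun x => g x - f x) := by
  unfold LpNorm
  simp_rw [abs_sub_comm]

lemma MemLpT.rpow_periodic {p : ℝ} {f : ℝ → ℝ} (hf : MemLpT p f) :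
    Function.Periodic (fun x => |f x| ^ p) 1 := fun x => by simp [hf.1 x]

lemma MemLpT.rpow_int {p : ℝ} {f : ℝ → ℝ} (hf : MemLpT p f) (a b : ℝ) :
    IntervalIntegrable (fun x => |f x| ^ p) volume a b :=
  hf.rpow_periodic.intervalIntegrable₀ one_ne_zero hf.2.2 a b

lemma MemLpT.shift {p : ℝ} {f : ℝ → ℝ} (t : ℝ) (hf : MemLpT p f) :
    MemLpT p (fun x => f (x + t)) := by
  refine ⟨fun x => ?_, hf.2.1.comp (measurable_id.add_const t), ?_⟩
  · show f (x + 1 + t) = f (x + t)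
    rw [← hf.1 (x + t)]; ring_nf
  · have := (hf.rpow_int t (1 + t)).comp_add_right t
    simpa using this

lemma LpNorm_shift {p : ℝ} {f : ℝ → ℝ} (t : ℝ) (hf : MemLpT p f) :
    LpNorm p (fun x => f (x + t)) = LpNorm p f := by
  unfold LpNorm
  congr 1
  rw [intervalIntegral.integral_comp_add_right (fun x => |f x| ^ p) t]
  have := hf.rpow_periodic.intervalIntegral_add_eq t 0
  simpa [add_comm] using this

lemma MemLpT.zero {p : ℝ} (hp : 1 ≤ p) : MemLpT p (fun _ => 0) :=
  ⟨fun _ => rfl, measurable_const, by simp⟩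

lemma LpNorm_zero' {p : ℝ} (hp : 1 ≤ p) : LpNorm p (fun _ => 0) = 0 := by
  unfold LpNorm
  have : p ≠ 0 := by linarith
  simp [Real.zero_rpow this, Real.zero_rpow (inv_ne_zero this)]

lemma shift_sum_bound {p : ℝ} (hp : 1 ≤ p) {f : ℝ → ℝ} (hf : MemLpT p f) (w t : ℕ → ℝ) (N : ℕ) :
    MemLpT p (fun x => ∑ k ∈ range N, w k * f (x + t k)) ∧
    LpNorm p (fun x => ∑ k ∈ range N, w k * f (x + t k)) ≤
      (∑ k ∈ range N, |w k|) * LpNorm p f := by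
  induction N with
  | zero => simp [MemLpT.zero hp, LpNorm_zero' hp]
  | succ N ih =>
    have h1 := (hf.shift (t N)).cmul hp (w N)
    simp_rw [sum_range_succ]
    refine ⟨ih.1.add hp h1, (LpNorm_add_le' hp ih.1 h1).trans ?_⟩
    rw [LpNorm_cmul hp _ (hf.shift (t N)), LpNorm_shift _ hf, add_mul]
    linarith [ih.2]

lemma memLpT_of_continuous {p : ℝ} (hp : 1 ≤ p) {f : ℝ → ℝ} (hper : Function.Periodic f 1)
    (hc : Continuous f) : MemLpT p f := by
  refine ⟨hper, hc.measurable, Continuous.intervalIntegrable ?_ 0 1⟩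
  exact hc.abs.rpow_const (fun _ => Or.inr (by linarith))

lemma MemLpT.int {p : ℝ} (hp : 1 ≤ p) {f : ℝ → ℝ} (hf : MemLpT p f) (a b : ℝ) :
    IntervalIntegrable f volume a b := by
  apply hf.1.intervalIntegrable₀ one_ne_zero
  rw [intervalIntegrable_iff_integrableOn_Ioc_of_le zero_le_one]
  exact (memLp_of_memLpT hp hf).integrable (by simpa using ENNReal.ofReal_le_ofReal hp)

/-- Jensen. -/
lemma jensen_int {p : ℝ} (hp : 1 ≤ p) {f : ℝ → ℝ} {a b : ℝ} (hab : a ≤ b)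
    (h1 : IntervalIntegrable f volume a b)
    (h2 : IntervalIntegrable (fun x => |f x| ^ p) volume a b) :
    (∫ x in a..b, |f x|) ^ p ≤ (b - a) ^ (p - 1) * ∫ x in a..b, |f x| ^ p := by
  rcases hab.eq_or_lt with rfl | hlt
  · have : p ≠ 0 := by linarith
    simp [Real.zero_rpow this, Real.zero_rpow (inv_ne_zero this)]
  have hd : 0 < b - a := by linarith
  have hpos : 0 ≤ ∫ x in a..b, |f x| := intervalIntegral.integral_nonneg hab (fun _ _ => abs_nonneg _)
  have key := (convexOn_rpow hp).map_set_average_le (μ := volume) (t := Set.Ioc a b)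
    (f := fun x => |f x|)
    (continuousOn_id.rpow_const (fun _ _ => Or.inr (by linarith))) isClosed_Ici
    (by simp [hlt]) (by simp) (by simp)
    ((intervalIntegrable_iff_integrableOn_Ioc_of_le hab).1 h1.abs)
    ((intervalIntegrable_iff_integrableOn_Ioc_of_le hab).1 h2)
  rw [setAverage_eq, setAverage_eq, ← intervalIntegral.integral_of_le hab,
    ← intervalIntegral.integral_of_le hab] at key
  simp only [measureReal_def, Real.volume_Ioc, ENNReal.toReal_ofReal hd.le, smul_eq_mul] at key
  rw [Real.mul_rpow (by positivity) hpos, Real.inv_rpow hd.le] at key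
  have hpp : (b - a) ^ p = (b - a) ^ (p - 1) * (b - a) := by
    rw [← Real.rpow_add_one hd.ne']; simp
  have h3 : 0 < (b - a) ^ p := by positivity
  calc _ = (b - a) ^ p * (((b - a) ^ p)⁻¹ * (∫ x in a..b, |f x|) ^ p) := by field_simp
    _ ≤ (b - a) ^ p * ((b - a)⁻¹ * ∫ x in a..b, |f x| ^ p) := by gcongr
    _ = _ := by rw [hpp]; field_simp

/-! ### Bernstein inequality -/

lemma exp_sum_orth (N : ℕ) (hN : 0 < N) (m : ℤ) (hm : |m| < N) :
    ∑ k ∈ range N, Complex.exp (2 * Real.pi * Complex.I * (m : ℂ) * ((k / N : ℝ) : ℂ)) =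
      if m = 0 then (N : ℂ) else 0 := by
  split_ifs with h0
  · simp [h0]
  have hNC : (N : ℂ) ≠ 0 := by exact_mod_cast hN.ne'
  set z : ℂ := Complex.exp (2 * Real.pi * Complex.I * m / N) with hz
  have h1 : ∀ k ∈ range N, Complex.exp (2 * Real.pi * Complex.I * (m : ℂ) * ((k / N : ℝ) : ℂ))
      = z ^ k := by
    intro k _
    rw [hz, ← Complex.exp_nat_mul]
    congr 1
    push_cast
    field_simp
  rw [sum_congr rfl h1]
  have hzN : z ^ N = 1 := by
    rw [hz, ← Complex.exp_nat_mul, Complex.exp_eq_one_iff]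
    exact ⟨m, by field_simp⟩
  have hz1 : z ≠ 1 := by
    intro h
    rw [hz, Complex.exp_eq_one_iff] at h
    obtain ⟨j, hj⟩ := h
    have hpi : (Real.pi : ℂ) ≠ 0 := by exact_mod_cast Real.pi_ne_zero
    have h3 : (m : ℂ) = j * N := by
      have hI := Complex.I_ne_zero
      field_simp at hj
      rw [hj]; ring
    have h4 : m = j * N := by exact_mod_cast h3
    rw [h4, abs_mul] at hm
    have h5 : j ≠ 0 := by rintro rfl; simp at h4; exact h0 h4
    have h6 : 1 ≤ |j| := Int.one_le_abs h5
    simp at hm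
    nlinarith
  have := mul_neg_geom_sum z N
  rw [hzN, sub_self] at this
  rcases mul_eq_zero.1 this with h | h
  · exact absurd (sub_eq_zero.1 h).symm hz1
  · exact h

lemma count_pairs (n : ℕ) (d : ℤ) (hd : 0 ≤ d) :
    ∑ a ∈ range n, ∑ b ∈ range n, (if (a : ℤ) - b + d = 0 then (1 : ℂ) else 0) =
      ((n - d.toNat : ℕ) : ℂ) := by
  obtain ⟨e, rfl⟩ := Int.eq_ofNat_of_zero_le hd
  have h1 : ∀ a ∈ range n, ∑ b ∈ range n, (if (a : ℤ) - b + e = 0 then (1 : ℂ) else 0) =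
      if a < n - e then 1 else 0 := by
    intro a _
    have h2 : ∀ b ∈ range n, (if (a : ℤ) - b + e = 0 then (1 : ℂ) else 0) =
        if a + e = b then 1 else 0 := by
      intro b _
      congr 1
      apply propext
      omega
    rw [sum_congr rfl h2, sum_ite_eq]
    congr 1
    simp only [mem_range, eq_iff_iff]
    omega
  rw [sum_congr rfl h1, ← sum_filter]
  have h3 : (range n).filter (fun a => a < n - e) = range (n - e) := by
    ext a; simp; omega
  rw [h3]; simp

lemma count_pairs' (n : ℕ) (d : ℤ) (hd : 0 ≤ d) :
    ∑ a ∈ range n, ∑ b ∈ range n, (if (a : ℤ) - b - d = 0 then (1 : ℂ) else 0) =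
      ((n - d.toNat : ℕ) : ℂ) := by
  rw [← count_pairs n d hd, sum_comm]
  refine sum_congr rfl fun a _ => sum_congr rfl fun b _ => ?_
  congr 1
  apply propext
  omega

lemma fejer_nonneg (n : ℕ) (t : ℝ) : ∃ F : ℝ, 0 ≤ F ∧
    (F : ℂ) = ∑ a ∈ range n, ∑ b ∈ range n,
      Complex.exp (2 * Real.pi * Complex.I * (((a : ℤ) - (b : ℤ) : ℤ) : ℂ) * (t : ℂ)) := by
  refine ⟨Complex.normSq (∑ a ∈ range n, Complex.exp (2 * Real.pi * Complex.I * (a : ℂ) * (t : ℂ))),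
    Complex.normSq_nonneg _, ?_⟩
  rw [← Complex.mul_conj, map_sum, sum_mul_sum]
  refine sum_congr rfl fun a _ => sum_congr rfl fun b _ => ?_
  rw [← Complex.exp_conj, ← Complex.exp_add]
  congr 1
  simp only [map_mul, Complex.conj_ofReal, Complex.conj_I, map_natCast, map_ofNat]
  push_cast
  ring

lemma bernstein_weights (n : ℕ) (hn : 1 ≤ n) : ∃ (N : ℕ) (w t : ℕ → ℝ),
    ∑ k ∈ range N, |w k| ≤ 4 * Real.pi * n ∧
    ∀ l : ℤ, |l| ≤ n → ∑ k ∈ range N, (w k : ℂ) *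
      Complex.exp (2 * Real.pi * Complex.I * (l : ℂ) * (t k : ℂ)) = 2 * Real.pi * Complex.I * l := by
  choose F hF0 hF using fejer_nonneg n
  set N : ℕ := 3 * n with hN
  have hNpos : 0 < N := by omega
  have hNC : (N : ℂ) ≠ 0 := by exact_mod_cast hNpos.ne'
  have hnC : (n : ℂ) ≠ 0 := by exact_mod_cast (by omega : n ≠ 0)
  -- coefficient computation
  have coef : ∀ m : ℤ, |m| ≤ 2 * n → ∑ k ∈ range N, (F (k / N : ℝ) : ℂ) *
      Complex.exp (2 * Real.pi * Complex.I * (m : ℂ) * ((k / N : ℝ) : ℂ)) =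
      N * ∑ a ∈ range n, ∑ b ∈ range n, (if (a : ℤ) - b + m = 0 then (1 : ℂ) else 0) := by
    intro m hm
    simp_rw [hF, sum_mul]
    rw [sum_comm, mul_sum]
    refine sum_congr rfl fun a ha => ?_
    rw [sum_comm, mul_sum]
    refine sum_congr rfl fun b hb => ?_
    have := exp_sum_orth N hNpos ((a : ℤ) - b + m) (by
      simp only [mem_range] at ha hb
      rw [abs_le] at hm
      rw [abs_lt, hN]
      constructor <;> push_cast <;> omega)
    rw [mul_ite, mul_one, mul_zero, ← this]
    refine sum_congr rfl fun k _ => ?_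
    rw [← Complex.exp_add]
    congr 1
    push_cast
    ring
  refine ⟨N, fun k => (4 * Real.pi / N) * Real.sin (2 * Real.pi * n * (k / N : ℝ)) * F (k / N : ℝ),
    fun k => (k / N : ℝ), ?_, ?_⟩
  · have h0 := coef 0 (by simp)
    have h1 := count_pairs n 0 le_rfl
    rw [h1] at h0
    have h2 : ∑ k ∈ range N, F (k / N : ℝ) = N * n := by
      have : ((∑ k ∈ range N, F (k / N : ℝ) : ℝ) : ℂ) = ((N * n : ℝ) : ℂ) := by
        push_cast
        simpa using h0
      exact_mod_cast this
    calc _ ≤ ∑ k ∈ range N, (4 * Real.pi / N) * F (k / N : ℝ) := by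
          refine sum_le_sum fun k _ => ?_
          rw [abs_mul, abs_mul, abs_of_nonneg (hF0 _), abs_of_nonneg (by positivity : 0 ≤ 4 * Real.pi / N)]
          have := Real.abs_sin_le_one (2 * Real.pi * n * (k / N : ℝ))
          have h3 : 0 ≤ 4 * Real.pi / N := by positivity
          have := mul_le_of_le_one_right h3 this
          exact mul_le_mul_of_nonneg_right this (hF0 _)
      _ = _ := by
          rw [← mul_sum, h2]
          have : (N : ℝ) ≠ 0 := by exact_mod_cast hNpos.ne'
          field_simp
  · intro l hl
    have hl' := abs_le.1 hl
    have h1 := coef (l + n) (by rw [abs_le]; omega)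
    have h2 := coef (l - n) (by rw [abs_le]; omega)
    rw [count_pairs n (l + n) (by omega)] at h1
    have e2 : ∑ a ∈ range n, ∑ b ∈ range n, (if (a : ℤ) - b + (l - n) = 0 then (1 : ℂ) else 0)
      = ((n - (n - l).toNat : ℕ) : ℂ) := by
      rw [← count_pairs' n (n - l) (by omega)]
      refine sum_congr rfl fun a _ => sum_congr rfl fun b _ => ?_
      congr 1
      apply propext
      omega
    rw [e2] at h2
    have h3 : (((n - (l + n).toNat : ℕ) : ℂ) - ((n - (n - l).toNat : ℕ) : ℂ)) = -l := by
      have : (((n - (l + n).toNat : ℕ) : ℤ) - ((n - (n - l).toNat : ℕ) : ℤ)) = -l := by omega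
      exact_mod_cast this
    have h4 : ∀ k ∈ range N, (((4 * Real.pi / N) * Real.sin (2 * Real.pi * n * (k / N : ℝ)) *
        F (k / N : ℝ) : ℝ) : ℂ) *
        Complex.exp (2 * Real.pi * Complex.I * (l : ℂ) * ((k / N : ℝ) : ℂ)) =
        (-2 * Real.pi * Complex.I / N) * ((F (k / N : ℝ) : ℂ) *
      Complex.exp (2 * Real.pi * Complex.I * ((l + n : ℤ) : ℂ) * ((k / N : ℝ) : ℂ)) -
        (F (k / N : ℝ) : ℂ) *
      Complex.exp (2 * Real.pi * Complex.I * ((l - n : ℤ) : ℂ) * ((k / N : ℝ) : ℂ))) := by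
      intro k _
      set τ : ℝ := (k / N : ℝ)
      have e1 : Complex.exp (2 * Real.pi * Complex.I * ((l + n : ℤ) : ℂ) * (τ : ℂ)) =
          Complex.exp (2 * Real.pi * Complex.I * (l : ℂ) * (τ : ℂ)) *
          Complex.exp (2 * Real.pi * n * τ * Complex.I) := by
        rw [← Complex.exp_add]; congr 1; push_cast; ring
      have e2 : Complex.exp (2 * Real.pi * Complex.I * ((l - n : ℤ) : ℂ) * (τ : ℂ)) =
          Complex.exp (2 * Real.pi * Complex.I * (l : ℂ) * (τ : ℂ)) *
          Complex.exp (-(2 * Real.pi * n * τ) * Complex.I) := by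
        rw [← Complex.exp_add]; congr 1; push_cast; ring
      rw [e1, e2]
      push_cast
      rw [Complex.sin]
      ring
    rw [sum_congr rfl h4, ← mul_sum, sum_sub_distrib, h1, h2, ← mul_sub, h3]
    field_simp

lemma IsTrigPoly.eq_re {n : ℕ} {T : ℝ → ℝ} {c : ℤ → ℂ} (hc : ∀ x : ℝ, (T x : ℂ) =
    ∑ ℓ ∈ Finset.Icc (-(n : ℤ)) (n : ℤ),
      c ℓ * Complex.exp (2 * Real.pi * Complex.I * (ℓ : ℂ) * (x : ℂ))) :
    T = fun x : ℝ => Complex.reCLM (∑ ℓ ∈ Finset.Icc (-(n : ℤ)) (n : ℤ),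
      c ℓ * Complex.exp (2 * Real.pi * Complex.I * (ℓ : ℂ) * (x : ℂ))) := by
  funext x
  rw [← hc x]; simp

lemma IsTrigPoly.contDiff {n : ℕ} {T : ℝ → ℝ} (hT : IsTrigPoly n T) (m : ℕ∞) :
    ContDiff ℝ m T := by
  obtain ⟨c, hc⟩ := hT
  rw [IsTrigPoly.eq_re hc]
  apply Complex.reCLM.contDiff.comp
  apply ContDiff.sum
  intro l _
  apply contDiff_const.mul
  apply ContDiff.cexp
  exact contDiff_const.mul Complex.ofRealCLM.contDiff

lemma IsTrigPoly.periodic {n : ℕ} {T : ℝ → ℝ} (hT : IsTrigPoly n T) : Function.Periodic T 1 := by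
  obtain ⟨c, hc⟩ := hT
  intro x
  have : (T (x + 1) : ℂ) = T x := by
    rw [hc, hc]
    refine sum_congr rfl fun l _ => ?_
    congr 1
    rw [Complex.exp_eq_exp_iff_exists_int]
    exact ⟨l, by push_cast; ring⟩
  exact_mod_cast this

lemma IsTrigPoly.mono {m n : ℕ} (hmn : m ≤ n) {T : ℝ → ℝ} (hT : IsTrigPoly m T) :
    IsTrigPoly n T := by
  obtain ⟨c, hc⟩ := hT
  refine ⟨fun l => if l ∈ Finset.Icc (-(m : ℤ)) (m : ℤ) then c l else 0, fun x => ?_⟩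
  rw [hc]
  have hsub : Finset.Icc (-(m : ℤ)) (m : ℤ) ⊆ Finset.Icc (-(n : ℤ)) (n : ℤ) := by
    apply Finset.Icc_subset_Icc <;> omega
  rw [← sum_subset hsub]
  · refine sum_congr rfl fun l hl => ?_
    simp only [if_pos hl]
  · intro l _ hl
    simp only [if_neg hl, zero_mul]

lemma IsTrigPoly.sub {n : ℕ} {T U : ℝ → ℝ} (hT : IsTrigPoly n T) (hU : IsTrigPoly n U) :
    IsTrigPoly n (fun x => T x - U x) := by
  obtain ⟨c, hc⟩ := hT
  obtain ⟨d, hd⟩ := hU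
  refine ⟨fun l => c l - d l, fun x => ?_⟩
  push_cast
  rw [hc, hd, ← sum_sub_distrib]
  refine sum_congr rfl fun l _ => ?_
  ring

lemma IsTrigPoly.memLpT {p : ℝ} (hp : 1 ≤ p) {n : ℕ} {T : ℝ → ℝ} (hT : IsTrigPoly n T) :
    MemLpT p T := memLpT_of_continuous hp hT.periodic (hT.contDiff 0).continuous

lemma bernstein_one {p : ℝ} (hp : 1 ≤ p) {n : ℕ} (hn : 1 ≤ n) {T : ℝ → ℝ} (hT : IsTrigPoly n T) :
    IsTrigPoly n (deriv T) ∧ LpNorm p (deriv T) ≤ (4 * Real.pi * n) * LpNorm p T := by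
  obtain ⟨N, w, t, hw, hl⟩ := bernstein_weights n hn
  have hTm := hT.memLpT hp
  obtain ⟨c, hc⟩ := hT
  have key : ∀ x : ℝ, ((∑ k ∈ range N, w k * T (x + t k) : ℝ) : ℂ) =
      ∑ ℓ ∈ Finset.Icc (-(n : ℤ)) (n : ℤ), (c ℓ * (2 * Real.pi * Complex.I * ℓ)) *
        Complex.exp (2 * Real.pi * Complex.I * (ℓ : ℂ) * (x : ℂ)) := by
    intro x
    push_cast
    simp_rw [hc, mul_sum]
    rw [sum_comm]
    refine sum_congr rfl fun l hl' => ?_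
    have hll := hl l (by rw [abs_le]; simpa using hl')
    have hll2 : ∀ z : ℂ, c l * (2 * Real.pi * Complex.I * l) * z = ∑ k ∈ range N, c l * ((w k : ℂ) *
      Complex.exp (2 * Real.pi * Complex.I * (l : ℂ) * (t k : ℂ))) * z := by
      intro z
      rw [← sum_mul, ← mul_sum, hll]
    rw [hll2]
    refine sum_congr rfl fun k _ => ?_
    have : Complex.exp (2 * Real.pi * Complex.I * (l : ℂ) * ((x + t k : ℝ) : ℂ)) =
      Complex.exp (2 * Real.pi * Complex.I * (l : ℂ) * (t k : ℂ)) *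
      Complex.exp (2 * Real.pi * Complex.I * (l : ℂ) * (x : ℂ)) := by
      rw [← Complex.exp_add]; congr 1; push_cast; ring
    rw [this]
    ring
  have hd : deriv T = fun x => ∑ k ∈ range N, w k * T (x + t k) := by
    funext x
    have h1 : HasDerivAt (fun x : ℝ => ∑ ℓ ∈ Finset.Icc (-(n : ℤ)) (n : ℤ),
      c ℓ * Complex.exp (2 * Real.pi * Complex.I * (ℓ : ℂ) * (x : ℂ)))
      ((∑ k ∈ range N, w k * T (x + t k) : ℝ) : ℂ) x := by
      rw [key]
      apply HasDerivAt.fun_sum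
      intro l _
      have h2 : HasDerivAt (fun x : ℝ => 2 * Real.pi * Complex.I * (l : ℂ) * (x : ℂ))
        (2 * Real.pi * Complex.I * (l : ℂ)) x := by
        simpa using (HasDerivAt.ofReal_comp (hasDerivAt_id x)).const_mul
          (2 * Real.pi * Complex.I * (l : ℂ))
      have h6 := (h2.cexp.const_mul (c l))
      have h7 : c l * (2 * Real.pi * Complex.I * l) *
        Complex.exp (2 * Real.pi * Complex.I * (l : ℂ) * (x : ℂ)) =
        c l * (Complex.exp (2 * Real.pi * Complex.I * (l : ℂ) * (x : ℂ)) *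
          (2 * Real.pi * Complex.I * l)) := by ring
      rw [h7]
      exact h6
    have h3 := Complex.reCLM.hasFDerivAt.comp_hasDerivAt x h1
    have h4 := IsTrigPoly.eq_re hc
    have h5 : HasDerivAt T (∑ k ∈ range N, w k * T (x + t k)) x := by
      have h8 : Complex.reCLM ((∑ k ∈ range N, w k * T (x + t k) : ℝ) : ℂ) =
        ∑ k ∈ range N, w k * T (x + t k) := by
        simp only [Complex.reCLM_apply, Complex.ofReal_re]
      rw [h8] at h3
      refine h3.congr_of_eventuallyEq (Eventually.of_forall fun y => ?_)
      exact congrFun h4 y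
    exact h5.deriv
  constructor
  · rw [hd]
    exact ⟨_, key⟩
  · rw [hd]
    refine (shift_sum_bound hp hTm w t N).2.trans ?_
    exact mul_le_mul_of_nonneg_right hw (LpNorm_nonneg' _ _)

lemma bernstein_lp {p : ℝ} (hp : 1 ≤ p) {n : ℕ} (hn : 1 ≤ n) (s : ℕ) {T : ℝ → ℝ}
    (hT : IsTrigPoly n T) :
    IsTrigPoly n (iteratedDeriv s T) ∧
      LpNorm p (iteratedDeriv s T) ≤ (4 * Real.pi * n) ^ s * LpNorm p T := by
  induction s with
  | zero => simpa using hT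
  | succ s ih =>
    rw [iteratedDeriv_succ]
    have := bernstein_one hp hn ih.1
    refine ⟨this.1, this.2.trans ?_⟩
    rw [pow_succ', mul_assoc (4 * Real.pi * (n : ℝ)) ((4 * Real.pi * (n : ℝ)) ^ s)]
    exact mul_le_mul_of_nonneg_left ih.2 (by positivity)

/-- The telescoping argument. -/
lemma telescoping {p : ℝ} (hp : 1 ≤ p) {s : ℕ} (hs : 1 ≤ s) {f : ℝ → ℝ} (hf : MemLpT p f)
    (T : ℕ → ℝ → ℝ) (hT0 : T 0 = fun _ => 0) (hT : ∀ ν, 1 ≤ ν → IsTrigPoly ν (T ν)) (n : ℕ)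
    (hn : 1 ≤ n) :
    LpNorm p (iteratedDeriv s (T n)) ≤
      (4 * Real.pi) ^ s * (n : ℝ) ^ s * LpNorm p (fun x => f x - T n x) +
      (8 * (4 * Real.pi) ^ s * 4 ^ s) * ∑ ν ∈ range (n / 2 + 1),
        ((ν : ℝ) + 1) ^ (s - 1) * LpNorm p (fun x => f x - T ν x) := by
  set e : ℕ → ℝ := fun ν => LpNorm p (fun x => f x - T ν x) with he
  have he0 : ∀ ν, 0 ≤ e ν := fun ν => LpNorm_nonneg' _ _
  set B : ℝ := (4 * Real.pi) ^ s with hB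
  have hBpos : 0 < B := by positivity
  have hTall : ∀ ν, ∀ m, 1 ≤ m → ν ≤ m → IsTrigPoly m (T ν) := by
    intro ν m hm hνm
    rcases Nat.eq_zero_or_pos ν with rfl | h
    · rw [hT0]; exact ⟨fun _ => 0, fun x => by simp⟩
    · exact (hT ν h).mono hνm
  -- basic step
  have step : ∀ m μ, 1 ≤ m → μ ≤ m → LpNorm p (iteratedDeriv s (T m)) ≤
      B * (m : ℝ) ^ s * (e m + e μ) + LpNorm p (iteratedDeriv s (T μ)) := by
    intro m μ hm hμ
    have h1 := hTall m m hm le_rfl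
    have h2 := hTall μ m hm hμ
    have hb := bernstein_lp hp hm s (h1.sub h2)
    have hb2 := bernstein_lp hp hm s h2
    have heq : iteratedDeriv s (T m) = fun x => iteratedDeriv s (fun x => T m x - T μ x) x +
        iteratedDeriv s (T μ) x := by
      funext x
      have := iteratedDeriv_fun_sub (n := s) (x := x) (h1.contDiff s).contDiffAt (h2.contDiff s).contDiffAt
      rw [this]; ring
    rw [heq]
    refine (LpNorm_add_le' hp (hb.1.memLpT hp) (hb2.1.memLpT hp)).trans ?_
    gcongr
    refine hb.2.trans ?_
    rw [mul_pow (4 * Real.pi)]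
    gcongr
    have h3 := LpNorm_sub_le' hp (hf.sub hp (h2.memLpT hp)) (hf.sub hp (h1.memLpT hp))
    have h4 : (fun x => T m x - T μ x) = fun x => (f x - T μ x) - (f x - T m x) := by
      funext x; ring
    rw [h4]; linarith
  induction n using Nat.strong_induction_on with
  | _ n ih =>
  rcases Nat.lt_or_ge n 2 with h2 | h2
  · obtain rfl : n = 1 := by omega
    have := step 1 0 le_rfl (by omega)
    have h0 : LpNorm p (iteratedDeriv s (T 0)) = 0 := by
      rw [hT0]
      have : iteratedDeriv s (fun _ : ℝ => (0:ℝ)) = fun _ => 0 := by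
        funext x
        simp [iteratedDeriv_const]
      rw [this, LpNorm_zero' hp]
    rw [h0] at this
    simp at this ⊢
    refine this.trans ?_
    have h3 : B ≤ 8 * B * 4 ^ s := by
      have : (1:ℝ) ≤ 4 ^ s := one_le_pow₀ (by norm_num)
      nlinarith
    have := mul_le_mul_of_nonneg_right h3 (he0 0)
    simp only [he] at this ⊢
    linarith
  · -- choose minimiser
    obtain ⟨μ, hμ, hmin⟩ := Finset.exists_min_image (Finset.Ioc (n / 4) (n / 2)) e
      ⟨n / 2, by simp; omega⟩
    simp only [Finset.mem_Ioc] at hμ hmin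
    have h3 := step n μ hn (by omega)
    have h4 := ih μ (by omega) (by omega)
    -- charge
    have hcharge : 2 * B * (n : ℝ) ^ s * e μ ≤ (8 * B * 4 ^ s) *
        ∑ ν ∈ Finset.Ioc (n / 4) (n / 2), ((ν : ℝ) + 1) ^ (s - 1) * e ν := by
      have hlow : ∀ ν ∈ Finset.Ioc (n / 4) (n / 2), ((n : ℝ) / 4) ^ (s - 1) * e μ ≤
          ((ν : ℝ) + 1) ^ (s - 1) * e ν := by
        intro ν hν
        have := hmin ν (by simpa using hν)
        simp only [Finset.mem_Ioc] at hν
        have h5 : (n : ℝ) ≤ 4 * (ν + 1) := by exact_mod_cast (by omega : n ≤ 4 * (ν + 1))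
        have h6 : (n : ℝ) / 4 ≤ ν + 1 := by linarith
        have := he0 μ
        gcongr
      have hsum := Finset.sum_le_sum hlow
      rw [Finset.sum_const, Nat.card_Ioc, nsmul_eq_mul] at hsum
      have hcard : (n : ℝ) ≤ 8 * ((n / 2 - n / 4 : ℕ) : ℝ) := by
        exact_mod_cast (by omega : n ≤ 8 * (n / 2 - n / 4))
      have hpow : (n : ℝ) ^ s = 4 ^ (s - 1) * ((n : ℝ) / 4) ^ (s - 1) * n := by
        obtain ⟨q, rfl⟩ : ∃ q, s = q + 1 := ⟨s - 1, by omega⟩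
        simp only [Nat.add_sub_cancel]
        rw [div_pow, pow_succ]; field_simp
      have h4s : (4:ℝ) ^ s = 4 ^ (s - 1) * 4 := by
        rw [← pow_succ]; congr 1; omega
      calc 2 * B * (n : ℝ) ^ s * e μ
          = 2 * B * 4 ^ (s - 1) * (((n : ℝ) / 4) ^ (s - 1) * e μ) * n := by rw [hpow]; ring
        _ ≤ 2 * B * 4 ^ (s - 1) * (((n : ℝ) / 4) ^ (s - 1) * e μ) *
            (8 * ((n / 2 - n / 4 : ℕ) : ℝ)) := by
            have := he0 μ
            gcongr
        _ = 16 * B * 4 ^ (s - 1) * (((n / 2 - n / 4 : ℕ) : ℝ) * (((n : ℝ) / 4) ^ (s - 1) * e μ)) := by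
            ring
        _ ≤ 16 * B * 4 ^ (s - 1) *
            ∑ ν ∈ Finset.Ioc (n / 4) (n / 2), ((ν : ℝ) + 1) ^ (s - 1) * e ν := by gcongr
        _ ≤ _ := by
            apply mul_le_mul_of_nonneg_right
            · rw [h4s]
              have : 0 < B * 4 ^ (s - 1) := by positivity
              nlinarith
            · apply Finset.sum_nonneg
              intro ν _
              have := he0 ν
              positivity
    have hsplit : ∑ ν ∈ range (μ / 2 + 1), ((ν : ℝ) + 1) ^ (s - 1) * e ν +
        ∑ ν ∈ Finset.Ioc (n / 4) (n / 2), ((ν : ℝ) + 1) ^ (s - 1) * e ν ≤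
        ∑ ν ∈ range (n / 2 + 1), ((ν : ℝ) + 1) ^ (s - 1) * e ν := by
      rw [← Finset.sum_union]
      · apply Finset.sum_le_sum_of_subset_of_nonneg
        · intro ν; simp; omega
        · intro ν _ _
          have := he0 ν
          positivity
      · rw [Finset.disjoint_left]
        intro ν; simp; omega
    have hμn : B * (μ : ℝ) ^ s * e μ ≤ B * (n : ℝ) ^ s * e μ := by
      have : (μ : ℝ) ≤ n := by exact_mod_cast (by omega : μ ≤ n)
      have := he0 μ
      gcongr
    have h7 := mul_le_mul_of_nonneg_left hsplit (by positivity : 0 ≤ 8 * B * 4 ^ s)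
    simp only [he] at *
    linarith

/-! ### Differences -/

lemma Delta_eq_iter (m : ℕ) (h : ℝ) (g : ℝ → ℝ) (y : ℝ) :
    Delta m h g y = (fwdDiff h)^[m] g y := by
  rw [fwdDiff_iter_eq_sum_shift, ← Finset.sum_range_reflect]
  unfold Delta
  refine sum_congr rfl fun ν hν => ?_
  have hν' : ν ≤ m := by simpa [Nat.lt_succ_iff] using hν
  have e1 : m + 1 - 1 - ν = m - ν := by omega
  have e2 : m - (m - ν) = ν := by omega
  rw [e1, e2, Nat.choose_symm hν', zsmul_eq_mul, nsmul_eq_mul]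
  push_cast [Nat.cast_sub hν']
  ring

lemma abs_int_mono {F : ℝ → ℝ} (hF : Continuous F) {a b c d : ℝ} (h1 : c ≤ a) (h2 : a ≤ b)
    (h3 : b ≤ d) : ∫ x in a..b, |F x| ≤ ∫ x in c..d, |F x| := by
  apply intervalIntegral.integral_mono_interval h1 h2 h3
  · exact Eventually.of_forall fun x => abs_nonneg _
  · exact hF.abs.intervalIntegrable _ _

lemma ftc_abs {g : ℝ → ℝ} (hg : ContDiff ℝ 1 g) {a b : ℝ} (hab : a ≤ b) :
    |g b - g a| ≤ ∫ x in a..b, |deriv g x| := by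
  rw [← intervalIntegral.integral_deriv_eq_sub (fun x _ => (hg.differentiable one_ne_zero) x)
    ((hg.continuous_deriv le_rfl).intervalIntegrable _ _)]
  exact intervalIntegral.abs_integral_le_integral_abs hab

lemma diff_bound_base (s : ℕ) : ∃ B : ℝ, 0 < B ∧ ∀ g : ℝ → ℝ, ContDiff ℝ ((s + 1 : ℕ) : ℕ∞) g →
    ∀ h : ℝ, 0 ≤ h → ∀ y : ℝ, |(fwdDiff h)^[s + 1] g y| ≤
      B * h ^ s * ∫ x in y..(y + ((s + 1 : ℕ) : ℝ) * h), |iteratedDeriv (s + 1) g x| := by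
  induction s with
  | zero =>
    refine ⟨1, one_pos, fun g hg h hh y => ?_⟩
    have := ftc_abs (g := g) (by simpa using hg) (a := y) (b := y + h) (by linarith)
    simpa [fwdDiff, iteratedDeriv_one] using this
  | succ s ih =>
    obtain ⟨B, hB, ih⟩ := ih
    refine ⟨B * (s + 1), by positivity, fun g hg h hh y => ?_⟩
    have hgs : ContDiff ℝ ((s + 1 : ℕ) : ℕ∞) g := hg.of_le (by
      exact_mod_cast (by omega : s + 1 ≤ s + 1 + 1))
    have hgc : ContDiff ℝ ((s + 1 : ℕ) : ℕ∞) (fun x => g (x + h)) :=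
      hgs.comp (contDiff_id.add contDiff_const)
    have hGd : ContDiff ℝ ((s + 1 : ℕ) : ℕ∞) (fwdDiff h g) := hgc.sub hgs
    have h1 := ih (fwdDiff h g) hGd h hh y
    rw [Function.iterate_succ_apply]
    refine h1.trans ?_
    set I := ∫ x in y..(y + ((s + 1 + 1 : ℕ) : ℝ) * h), |iteratedDeriv (s + 1 + 1) g x| with hI
    have hgder : ContDiff ℝ 1 (iteratedDeriv (s + 1) g) := by
      exact (contDiff_nat_succ_iff_contDiff_one_iteratedDeriv.1 (by exact_mod_cast hg)).2
    have hcont2 : Continuous (iteratedDeriv (s + 1 + 1) g) := by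
      rw [iteratedDeriv_succ]; exact hgder.continuous_deriv le_rfl
    have hpt : ∀ u ∈ Set.Icc y (y + ((s + 1 : ℕ) : ℝ) * h),
        |iteratedDeriv (s + 1) (fwdDiff h g) u| ≤ I := by
      intro u hu
      have e1 : iteratedDeriv (s + 1) (fwdDiff h g) u =
          iteratedDeriv (s + 1) g (u + h) - iteratedDeriv (s + 1) g u := by
        have := iteratedDeriv_fun_sub (n := s + 1) (x := u) (f := fun x => g (x + h)) (g := g)
          hgc.contDiffAt hgs.contDiffAt
        have h3 := iteratedDeriv_comp_add_const (s + 1) g h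
        rw [h3] at this
        exact this
      rw [e1]
      have h5 := ftc_abs hgder (a := u) (b := u + h) (by linarith)
      rw [← iteratedDeriv_succ] at h5
      refine h5.trans (abs_int_mono hcont2 hu.1 (by linarith) ?_)
      have := hu.2
      push_cast at this ⊢
      linarith
    have hle : y ≤ y + ((s + 1 : ℕ) : ℝ) * h := by
      have : 0 ≤ ((s + 1 : ℕ) : ℝ) * h := by positivity
      linarith
    have hGc : Continuous (iteratedDeriv (s + 1) (fwdDiff h g)) := by
      apply hGd.continuous_iteratedDeriv; exact_mod_cast le_rfl
    have h6 : ∫ x in y..(y + ((s + 1 : ℕ) : ℝ) * h), |iteratedDeriv (s + 1) (fwdDiff h g) x| ≤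
        ∫ x in y..(y + ((s + 1 : ℕ) : ℝ) * h), I :=
      intervalIntegral.integral_mono_on hle (hGc.abs.intervalIntegrable _ _)
        (continuous_const.intervalIntegrable _ _) hpt
    rw [intervalIntegral.integral_const, smul_eq_mul] at h6
    calc _ ≤ B * h ^ s * ((y + ((s + 1 : ℕ) : ℝ) * h - y) * I) := by gcongr
      _ = _ := by push_cast; ring

lemma diff_bound (s : ℕ) (hs : 1 ≤ s) (m : ℕ) (hm : s ≤ m) : ∃ B : ℝ, 0 < B ∧ ∀ g : ℝ → ℝ,
    ContDiff ℝ (s : ℕ∞) g →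
    ∀ h : ℝ, 0 ≤ h → ∀ y : ℝ, |Delta m h g y| ≤
      B * h ^ (s - 1) * ∫ x in y..(y + (m : ℝ) * h), |iteratedDeriv s g x| := by
  simp_rw [Delta_eq_iter]
  induction m, hm using Nat.le_induction with
  | base =>
    obtain ⟨q, rfl⟩ : ∃ q, s = q + 1 := ⟨s - 1, by omega⟩
    exact diff_bound_base q
  | succ m hm ih =>
    obtain ⟨B, hB, ih⟩ := ih
    refine ⟨2 * B, by positivity, fun g hg h hh y => ?_⟩
    have hc : Continuous (iteratedDeriv s g) := by
      apply hg.continuous_iteratedDeriv; exact_mod_cast le_rfl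
    have hmh : 0 ≤ (m : ℝ) * h := by positivity
    rw [Function.iterate_succ_apply']
    have h1 := ih g hg h hh y
    have h2 := ih g hg h hh (y + h)
    have h3 : ∫ x in y..(y + (m : ℝ) * h), |iteratedDeriv s g x| ≤
        ∫ x in y..(y + ((m + 1 : ℕ) : ℝ) * h), |iteratedDeriv s g x| :=
      abs_int_mono hc le_rfl (by linarith) (by push_cast; linarith)
    have h4 : ∫ x in (y + h)..(y + h + (m : ℝ) * h), |iteratedDeriv s g x| ≤
        ∫ x in y..(y + ((m + 1 : ℕ) : ℝ) * h), |iteratedDeriv s g x| :=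
      abs_int_mono hc (by linarith) (by linarith) (by push_cast; linarith)
    have h5 : 0 ≤ B * h ^ (s - 1) := by positivity
    have h6 := mul_le_mul_of_nonneg_left h3 h5
    have h7 := mul_le_mul_of_nonneg_left h4 h5
    have h8 := abs_sub ((fwdDiff h)^[m] g (y + h)) ((fwdDiff h)^[m] g y)
    rw [fwdDiff]
    linarith

/-! ### Modulus of smoothness of a smooth function -/

lemma LpNorm_rpow {p : ℝ} (hp : 1 ≤ p) (f : ℝ → ℝ) :
    LpNorm p f ^ p = ∫ x in (0:ℝ)..1, |f x| ^ p := by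
  unfold LpNorm
  rw [← Real.rpow_mul, one_div, inv_mul_cancel₀ (by linarith), Real.rpow_one]
  exact intervalIntegral.integral_nonneg zero_le_one fun x _ => by positivity

lemma le_of_rpow_le' {p a b : ℝ} (hp : 1 ≤ p) (hb : 0 ≤ b) (h : a ^ p ≤ b ^ p) (ha : 0 ≤ a) :
    a ≤ b := (Real.rpow_le_rpow_iff ha hb (by linarith)).1 h

/-- `‖∫_x^{x+L} |F|‖_p ≤ L ‖F‖_p`. -/
lemma LpNorm_window {p : ℝ} (hp : 1 ≤ p) {F : ℝ → ℝ} (hF : Continuous F)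
    (hper : Function.Periodic F 1) {L : ℝ} (hL : 0 ≤ L) {u : ℝ → ℝ} (hu : Continuous u) {A : ℝ}
    (hA : 0 ≤ A) (hb : ∀ x, |u x| ≤ A * ∫ y in x..(x + L), |F y|) :
    LpNorm p u ≤ A * L * LpNorm p F := by
  have hp0 : (0:ℝ) ≤ p := by linarith
  have hFm := memLpT_of_continuous hp hper hF
  apply le_of_rpow_le' hp (by have := LpNorm_nonneg' p F; positivity) _ (LpNorm_nonneg' _ _)
  rw [LpNorm_rpow hp, Real.mul_rpow (by positivity) (LpNorm_nonneg' _ _), LpNorm_rpow hp]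
  have hFc : Continuous fun x => |F x| ^ p := hF.abs.rpow_const (fun _ => Or.inr hp0)
  have hpt : ∀ x, |u x| ^ p ≤ (A ^ p * L ^ (p - 1)) * ∫ y in (0:ℝ)..L, |F (y + x)| ^ p := by
    intro x
    have h1 := jensen_int hp (a := x) (b := x + L) (by linarith) (hF.intervalIntegrable _ _)
      (hFc.intervalIntegrable _ _)
    rw [intervalIntegral.integral_comp_add_right (fun y => |F y| ^ p) x, zero_add, add_comm L x]
    have hI : 0 ≤ ∫ y in x..(x + L), |F y| :=
      intervalIntegral.integral_nonneg (by linarith) fun _ _ => abs_nonneg _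
    calc |u x| ^ p ≤ (A * ∫ y in x..(x + L), |F y|) ^ p :=
          Real.rpow_le_rpow (abs_nonneg _) (hb x) hp0
      _ = A ^ p * (∫ y in x..(x + L), |F y|) ^ p := Real.mul_rpow hA hI
      _ ≤ A ^ p * ((x + L - x) ^ (p - 1) * ∫ y in x..(x + L), |F y| ^ p) := by gcongr
      _ = _ := by rw [add_sub_cancel_left, mul_assoc]
  have hc2 : Continuous (Function.uncurry fun x y : ℝ => |F (y + x)| ^ p) :=
    hFc.comp (continuous_snd.add continuous_fst)
  have hc1 : Continuous fun x => ∫ y in (0:ℝ)..L, |F (y + x)| ^ p :=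
    intervalIntegral.continuous_parametric_intervalIntegral_of_continuous' hc2 0 L
  have hswap : ∫ x in (0:ℝ)..1, ∫ y in (0:ℝ)..L, |F (y + x)| ^ p =
      L * ∫ x in (0:ℝ)..1, |F x| ^ p := by
    rw [intervalIntegral_intervalIntegral_swap]
    · have : ∀ y : ℝ, ∫ x in (0:ℝ)..1, |F (y + x)| ^ p = ∫ x in (0:ℝ)..1, |F x| ^ p := by
        intro y
        rw [intervalIntegral.integral_comp_add_left (fun x => |F x| ^ p) y, add_zero]
        have := hFm.rpow_periodic.intervalIntegral_add_eq y 0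
        simpa using this
      simp_rw [this]
      simp
    · have hK : IsCompact ((Set.uIcc (0:ℝ) 1) ×ˢ (Set.uIcc (0:ℝ) L)) :=
        isCompact_uIcc.prod isCompact_uIcc
      have := hc2.continuousOn.integrableOn_compact (μ := volume) hK
      exact this.mono_set (Set.prod_mono Set.uIoc_subset_uIcc Set.uIoc_subset_uIcc)
  calc ∫ x in (0:ℝ)..1, |u x| ^ p
      ≤ ∫ x in (0:ℝ)..1, (A ^ p * L ^ (p - 1)) * ∫ y in (0:ℝ)..L, |F (y + x)| ^ p := by
        apply intervalIntegral.integral_mono_on zero_le_one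
        · exact (hu.abs.rpow_const (fun _ => Or.inr hp0)).intervalIntegrable _ _
        · exact (continuous_const.mul hc1).intervalIntegrable _ _
        · exact fun x _ => hpt x
    _ = (A ^ p * (L ^ (p - 1) * L)) * ∫ x in (0:ℝ)..1, |F x| ^ p := by
        rw [intervalIntegral.integral_const_mul, hswap]; ring
    _ = _ := by
        rw [Real.mul_rpow hA hL]
        congr 2
        rcases hL.eq_or_lt with rfl | h
        · simp [Real.zero_rpow (by linarith : p ≠ 0)]
        · rw [← Real.rpow_add_one h.ne']; simp

lemma Delta_lp_bound {p : ℝ} (hp : 1 ≤ p) {f : ℝ → ℝ} (hf : MemLpT p f) (s : ℕ) (h : ℝ) :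
    MemLpT p (Delta s h f) ∧ LpNorm p (Delta s h f) ≤ 2 ^ s * LpNorm p f := by
  have h1 := shift_sum_bound hp hf (fun ν => (-1 : ℝ) ^ ν * (s.choose ν : ℝ))
    (fun ν => ((s : ℝ) - (ν : ℝ)) * h) (s + 1)
  refine ⟨h1.1, h1.2.trans (le_of_eq ?_)⟩
  congr 1
  have : ∀ ν ∈ range (s + 1), |(-1 : ℝ) ^ ν * (s.choose ν : ℝ)| = (s.choose ν : ℝ) := by
    intro ν _
    rw [abs_mul, abs_pow]; simp
  rw [sum_congr rfl this]
  exact_mod_cast Nat.sum_range_choose s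

lemma Delta_sub' (s : ℕ) (h : ℝ) (f g : ℝ → ℝ) (x : ℝ) :
    Delta s h f x = Delta s h (fun x => f x - g x) x + Delta s h g x := by
  unfold Delta
  rw [← sum_add_distrib]
  refine sum_congr rfl fun ν _ => ?_
  ring

lemma omega_bound {p : ℝ} (hp : 1 ≤ p) {s : ℕ} (hs : 1 ≤ s) : ∃ C : ℝ, 0 < C ∧
    ∀ f g : ℝ → ℝ, MemLpT p f → Function.Periodic g 1 → (∀ m : ℕ∞, ContDiff ℝ m g) →
    Function.Periodic (iteratedDeriv s g) 1 → ∀ n : ℕ, 1 ≤ n →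
    omegaMod s p f (1 / (n : ℝ)) ≤ C * (LpNorm p (fun x => f x - g x) +
      1 / (n : ℝ) ^ s * LpNorm p (iteratedDeriv s g)) := by
  obtain ⟨B, hB, hd⟩ := diff_bound s hs s le_rfl
  refine ⟨2 ^ s + B * s, by positivity, fun f g hf hgp hg hgsp n hn => ?_⟩
  have hgm := memLpT_of_continuous hp hgp (hg 0).continuous
  have hc : Continuous (iteratedDeriv s g) := (hg s).continuous_iteratedDeriv s (by exact_mod_cast le_rfl)
  have hn0 : (0:ℝ) < n := by exact_mod_cast hn
  have hE := LpNorm_nonneg' p (fun x => f x - g x)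
  have hD := LpNorm_nonneg' p (iteratedDeriv s g)
  apply Real.sSup_le
  · rintro y ⟨h, h0, h1, rfl⟩
    have hDc : Continuous (Delta s h g) := by
      unfold Delta
      have := (hg 0).continuous
      fun_prop
    have e1 := LpNorm_window hp hc hgsp (L := s * h) (by positivity) hDc
      (A := B * h ^ (s - 1)) (by positivity) (fun x => hd g (hg s) h h0.le x)
    have e2 := Delta_lp_bound hp (hf.sub hp hgm) s h
    have e3 := Delta_lp_bound hp hgm s h
    have e4 : Delta s h f = fun x => Delta s h (fun x => f x - g x) x + Delta s h g x :=
      funext fun x => Delta_sub' s h f g x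
    rw [e4]
    have e5 := LpNorm_add_le' hp e2.1 e3.1
    have e6 : h ^ (s - 1) * h ≤ 1 / (n : ℝ) ^ s := by
      rw [← pow_succ, Nat.sub_add_cancel hs, ← one_div_pow]
      gcongr
    have e7 : B * h ^ (s - 1) * (s * h) * LpNorm p (iteratedDeriv s g) ≤
        B * s * (1 / (n : ℝ) ^ s * LpNorm p (iteratedDeriv s g)) := by
      calc _ = B * s * ((h ^ (s - 1) * h) * LpNorm p (iteratedDeriv s g)) := by ring
        _ ≤ _ := by gcongr
    have e8 : 0 ≤ 1 / (n : ℝ) ^ s * LpNorm p (iteratedDeriv s g) := by positivity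
    have e9 : 0 ≤ (2:ℝ) ^ s * (1 / (n : ℝ) ^ s * LpNorm p (iteratedDeriv s g)) := by positivity
    have e10 : 0 ≤ B * s * LpNorm p (fun x => f x - g x) := by positivity
    linarith [e2.2]
  · positivity

/-! ### Discrete norm and Steklov means -/

lemma ellp_add_le {p : ℝ} (hp : 1 ≤ p) (n : ℕ) (x : ℕ → ℝ) (f g : ℝ → ℝ) :
    ellp p n x (fun t => f t + g t) ≤ ellp p n x f + ellp p n x g := by
  unfold ellp
  have h0 : ∀ f : ℝ → ℝ, 0 ≤ ∑ k ∈ range n, |f (x k)| ^ p :=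
    fun f => sum_nonneg fun k _ => by positivity
  have hn : (0:ℝ) ≤ 1 / n := by positivity
  rw [Real.mul_rpow hn (h0 f), Real.mul_rpow hn (h0 g),
    Real.mul_rpow hn (h0 fun t => f t + g t), ← mul_add]
  have := Real.Lp_add_le (range n) (fun k => f (x k)) (fun k => g (x k)) hp
  gcongr

lemma ellp_nonneg (p : ℝ) (n : ℕ) (x : ℕ → ℝ) (f : ℝ → ℝ) : 0 ≤ ellp p n x f := by
  unfold ellp
  apply Real.rpow_nonneg
  have : 0 ≤ ∑ k ∈ range n, |f (x k)| ^ p := sum_nonneg fun k _ => by positivity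
  positivity

lemma ellp_sub_comm (p : ℝ) (n : ℕ) (x : ℕ → ℝ) (f g : ℝ → ℝ) :
    ellp p n x (fun t => f t - g t) = ellp p n x (fun t => g t - f t) := by
  unfold ellp
  simp_rw [abs_sub_comm]

lemma nodes_disjoint {γ : ℝ} (hγ0 : 0 < γ) {X : ℕ → ℕ → ℝ} (hX : NodesOK γ X) {n : ℕ} (hn : 1 ≤ n)
    {H : ℝ → ℝ} (hH0 : ∀ x, 0 ≤ H x) (hper : Function.Periodic H 1)
    (hH_int : ∀ a b, IntervalIntegrable H volume a b) :
    ∑ k ∈ range n, ∫ y in (X n k - γ / n / 2)..(X n k + γ / n / 2), H y ≤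
      ∫ y in (0:ℝ)..1, H y := by
  obtain ⟨_, _, _, hsep, hlast⟩ := hX n hn
  set δ := γ / (n : ℝ) with hδ
  have hδ0 : 0 < δ := by
    have : (0:ℝ) < n := by exact_mod_cast hn
    positivity
  have key : ∀ m, m < n → (X n 0 ≤ X n m) ∧
      ∑ k ∈ range (m + 1), ∫ y in (X n k - δ / 2)..(X n k + δ / 2), H y ≤
      ∫ y in (X n 0 - δ / 2)..(X n m + δ / 2), H y := by
    intro m
    induction m with
    | zero => intro _; simp
    | succ m ih =>
      intro hm
      obtain ⟨h1, h2⟩ := ih (by omega)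
      have h3 := hsep m hm
      refine ⟨by linarith, ?_⟩
      rw [sum_range_succ]
      have e1 := intervalIntegral.integral_add_adjacent_intervals
        (hH_int (X n 0 - δ / 2) (X n m + δ / 2)) (hH_int (X n m + δ / 2) (X n (m + 1) - δ / 2))
      have e2 := intervalIntegral.integral_add_adjacent_intervals
        (hH_int (X n 0 - δ / 2) (X n (m + 1) - δ / 2))
        (hH_int (X n (m + 1) - δ / 2) (X n (m + 1) + δ / 2))
      have e3 : 0 ≤ ∫ y in (X n m + δ / 2)..(X n (m + 1) - δ / 2), H y :=
        intervalIntegral.integral_nonneg (by linarith) fun _ _ => hH0 _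
      linarith
  have h := key (n - 1) (by omega)
  rw [Nat.sub_add_cancel hn] at h
  refine h.2.trans ?_
  have h1 : ∫ y in (X n 0 - δ / 2)..(X n (n - 1) + δ / 2), H y ≤
      ∫ y in (X n 0 - δ / 2)..(X n 0 - δ / 2 + 1), H y := by
    apply intervalIntegral.integral_mono_interval le_rfl (by linarith) (by linarith)
    · exact Eventually.of_forall fun x => hH0 x
    · exact hH_int _ _
  refine h1.trans (le_of_eq ?_)
  have := hper.intervalIntegral_add_eq (X n 0 - δ / 2) 0
  simpa using this

lemma ellp_window {p γ : ℝ} (hp : 1 ≤ p) (hγ0 : 0 < γ) (hγ1 : γ ≤ 1) {X : ℕ → ℕ → ℝ}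
    (hX : NodesOK γ X) {n : ℕ} (hn : 1 ≤ n) {h u : ℝ → ℝ} (hh : MemLpT p h) {A : ℝ} (hA : 0 ≤ A)
    (hb : ∀ x, |u x| ≤ A * ∫ y in (x - γ / n / 2)..(x + γ / n / 2), |h y|) :
    ellp p n (X n) u ≤ A / n * LpNorm p h := by
  have hp0 : 0 < p := by linarith
  have hn0 : (0:ℝ) < n := by exact_mod_cast hn
  have hN := LpNorm_nonneg' p h
  have hδ0 : 0 < γ / (n : ℝ) := by positivity
  unfold ellp
  have h0 : 0 ≤ (1 / (n : ℝ)) * ∑ k ∈ range n, |u (X n k)| ^ p := by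
    have : 0 ≤ ∑ k ∈ range n, |u (X n k)| ^ p := sum_nonneg fun k _ => by positivity
    positivity
  apply le_of_rpow_le' hp (by positivity) _ (by positivity)
  rw [← Real.rpow_mul h0, one_div p, inv_mul_cancel₀ hp0.ne', Real.rpow_one]
  have hpt : ∀ k ∈ range n, |u (X n k)| ^ p ≤ (A ^ p * (γ / n) ^ (p - 1)) *
      ∫ y in (X n k - γ / n / 2)..(X n k + γ / n / 2), |h y| ^ p := by
    intro k _
    set x := X n k
    have h1 := jensen_int hp (a := x - γ / n / 2) (b := x + γ / n / 2) (by linarith)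
      (hh.int hp _ _) (hh.rpow_int _ _)
    have hI : 0 ≤ ∫ y in (x - γ / n / 2)..(x + γ / n / 2), |h y| :=
      intervalIntegral.integral_nonneg (by linarith) fun _ _ => abs_nonneg _
    calc |u x| ^ p ≤ (A * ∫ y in (x - γ / n / 2)..(x + γ / n / 2), |h y|) ^ p :=
          Real.rpow_le_rpow (abs_nonneg _) (hb x) hp0.le
      _ = A ^ p * (∫ y in (x - γ / n / 2)..(x + γ / n / 2), |h y|) ^ p := Real.mul_rpow hA hI
      _ ≤ _ := by
        have e : x + γ / n / 2 - (x - γ / n / 2) = γ / n := by ring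
        rw [e] at h1
        rw [mul_assoc]
        gcongr
  have hdis := nodes_disjoint hγ0 hX hn (H := fun y => |h y| ^ p) (fun x => by positivity)
    hh.rpow_periodic hh.rpow_int
  rw [← LpNorm_rpow hp] at hdis
  have hsum : ∑ k ∈ range n, |u (X n k)| ^ p ≤ (A ^ p * (γ / n) ^ (p - 1)) * LpNorm p h ^ p := by
    refine (sum_le_sum hpt).trans ?_
    rw [← mul_sum]
    gcongr
  have hγp : γ ^ (p - 1) ≤ 1 := Real.rpow_le_one hγ0.le hγ1 (by linarith)
  have hnp : (n : ℝ) ^ p = (n : ℝ) ^ (p - 1) * n := by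
    rw [← Real.rpow_add_one hn0.ne']; simp
  calc _ ≤ (1 / (n : ℝ)) * ((A ^ p * (γ / n) ^ (p - 1)) * LpNorm p h ^ p) := by gcongr
    _ = γ ^ (p - 1) * (A ^ p / n ^ p * LpNorm p h ^ p) := by
        rw [Real.div_rpow hγ0.le hn0.le, hnp]; field_simp
    _ ≤ 1 * (A ^ p / n ^ p * LpNorm p h ^ p) := by gcongr
    _ = _ := by
        rw [one_mul, Real.mul_rpow (by positivity) hN, Real.div_rpow hA hn0.le]

lemma int_comp {p : ℝ} (hp : 1 ≤ p) {f : ℝ → ℝ} (hf : MemLpT p f) (x : ℝ) {c : ℝ} (hc : c ≠ 0)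
    (a b : ℝ) : IntervalIntegrable (fun t => f (x + c * t)) volume a b := by
  have h1 := (hf.int hp (x + c * a) (x + c * b)).comp_add_left x
  have h2 := h1.comp_mul_left (c := c)
  have e1 : (x + c * a - x) / c = a := by field_simp; ring
  have e2 : (x + c * b - x) / c = b := by field_simp; ring
  rw [e1, e2] at h2
  exact h2

lemma coef_pos {r ν : ℕ} (hν : ν ∈ range r) : 0 < ((r : ℝ) - (ν : ℝ)) / (r : ℝ) ∧
    ((r : ℝ) - (ν : ℝ)) / (r : ℝ) ≤ 1 ∧ (((r : ℝ) - (ν : ℝ)) / (r : ℝ))⁻¹ ≤ r := by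
  simp only [mem_range] at hν
  have h1 : (ν : ℝ) + 1 ≤ r := by exact_mod_cast hν
  have h2 : (0:ℝ) ≤ ν := by positivity
  have h3 : (0:ℝ) < r := by linarith
  have h4 : (0:ℝ) < r - ν := by linarith
  refine ⟨by positivity, ?_, ?_⟩
  · rw [div_le_one h3]; linarith
  · rw [inv_div, div_le_iff₀ h4]; nlinarith

lemma steklov_sub {p : ℝ} (hp : 1 ≤ p) {f g : ℝ → ℝ} (hf : MemLpT p f) (hg : MemLpT p g)
    (r : ℕ) (δ x : ℝ) :
    steklov r δ f x = steklov r δ (fun t => f t - g t) x + steklov r δ g x := by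
  unfold steklov
  rw [← mul_add]
  congr 1
  have hI : ∀ f : ℝ → ℝ, MemLpT p f → IntervalIntegrable (fun t => ∑ ν ∈ Finset.range r,
        (-1 : ℝ) ^ ν * (((2 * r).choose ν : ℝ)) * f (x + (((r : ℝ) - (ν : ℝ)) / (r : ℝ)) * t))
        volume (-(δ / 2)) (δ / 2) := by
    intro f hf
    have := IntervalIntegrable.sum (μ := volume) (a := -(δ / 2)) (b := δ / 2) (Finset.range r)
      (f := fun ν t => (-1 : ℝ) ^ ν * (((2 * r).choose ν : ℝ)) *
        f (x + (((r : ℝ) - (ν : ℝ)) / (r : ℝ)) * t))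
      (fun ν hν => (int_comp hp hf x (coef_pos hν).1.ne' _ _).const_mul _)
    rw [Finset.sum_fn] at this
    exact this
  rw [← intervalIntegral.integral_add (hI _ (hf.sub hp hg)) (hI _ hg)]
  congr 1
  funext t
  rw [← sum_add_distrib]
  refine sum_congr rfl fun ν _ => ?_
  ring

lemma choose_inv_le (r : ℕ) : (((2 * r).choose r : ℝ))⁻¹ ≤ 1 := by
  apply inv_le_one_of_one_le₀
  exact_mod_cast Nat.choose_pos (by omega : r ≤ 2 * r)

lemma steklov_bound {p : ℝ} (hp : 1 ≤ p) {h : ℝ → ℝ} (hh : MemLpT p h) (r : ℕ) {δ : ℝ}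
    (hδ : 0 < δ) (x : ℝ) :
    |steklov r δ h x| ≤ ((2 / δ) * (r * 4 ^ r)) * ∫ y in (x - δ / 2)..(x + δ / 2), |h y| := by
  set I := ∫ y in (x - δ / 2)..(x + δ / 2), |h y| with hI
  have hI0 : 0 ≤ I := intervalIntegral.integral_nonneg (by linarith) fun _ _ => abs_nonneg _
  have hterm : ∀ ν ∈ range r, |∫ t in (-(δ / 2))..(δ / 2), (-1 : ℝ) ^ ν * (((2 * r).choose ν : ℝ)) *
      h (x + (((r : ℝ) - (ν : ℝ)) / (r : ℝ)) * t)| ≤ ((2 * r).choose ν : ℝ) * (r * I) := by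
    intro ν hν
    obtain ⟨c0, c1, c2⟩ := coef_pos hν
    set c := ((r : ℝ) - (ν : ℝ)) / (r : ℝ)
    rw [intervalIntegral.integral_const_mul, abs_mul, abs_mul, abs_pow, abs_neg, abs_one, one_pow,
      one_mul, Nat.abs_cast]
    gcongr
    refine (intervalIntegral.abs_integral_le_integral_abs (by linarith)).trans ?_
    rw [intervalIntegral.integral_comp_add_mul (fun y => |h y|) c0.ne' x, smul_eq_mul]
    have h1 : ∫ y in (x + c * -(δ / 2))..(x + c * (δ / 2)), |h y| ≤ I := by
      apply intervalIntegral.integral_mono_interval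
      · nlinarith
      · nlinarith
      · nlinarith
      · exact Eventually.of_forall fun x => abs_nonneg _
      · exact (hh.int hp _ _).abs
    calc _ ≤ c⁻¹ * I := by gcongr
      _ ≤ _ := by gcongr
  have hsum : |∫ t in (-(δ / 2))..(δ / 2), ∑ ν ∈ Finset.range r,
        (-1 : ℝ) ^ ν * (((2 * r).choose ν : ℝ)) * h (x + (((r : ℝ) - (ν : ℝ)) / (r : ℝ)) * t)| ≤
        4 ^ r * (r * I) := by
    rw [intervalIntegral.integral_finsetSum
      (fun ν hν => (int_comp hp hh x (coef_pos hν).1.ne' _ _).const_mul _)]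
    refine (abs_sum_le_sum_abs _ _).trans ((sum_le_sum hterm).trans ?_)
    rw [← sum_mul]
    gcongr
    have h1 : ∑ ν ∈ range r, (2 * r).choose ν ≤ ∑ ν ∈ range (2 * r + 1), (2 * r).choose ν :=
      sum_le_sum_of_subset (by intro a; simp; omega)
    rw [Nat.sum_range_choose, pow_mul] at h1
    exact_mod_cast h1
  unfold steklov
  rw [abs_mul, abs_mul, abs_mul, abs_pow, abs_neg, abs_one, one_pow, one_mul,
    abs_of_nonneg (by positivity : 0 ≤ (((2 * r).choose r : ℝ))⁻¹),
    abs_of_nonneg (by positivity : 0 ≤ 2 / δ)]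
  calc _ ≤ 1 * (2 / δ) * (4 ^ r * (r * I)) := by
        gcongr
        exact choose_inv_le r
    _ = _ := by ring

/-! ### Steklov averages of smooth functions -/

lemma Delta_split (r : ℕ) (hr : 1 ≤ r) (g : ℝ → ℝ) (x t : ℝ) :
    Delta (2 * r) (t / r) g (x - t) =
      (∑ ν ∈ range r, (-1 : ℝ) ^ ν * (((2 * r).choose ν : ℝ)) *
        g (x + (((r : ℝ) - (ν : ℝ)) / (r : ℝ)) * t)) +
      (∑ ν ∈ range r, (-1 : ℝ) ^ ν * (((2 * r).choose ν : ℝ)) *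
        g (x + (((r : ℝ) - (ν : ℝ)) / (r : ℝ)) * (-t))) +
      (-1 : ℝ) ^ r * ((2 * r).choose r : ℝ) * g x := by
  have hr0 : (r : ℝ) ≠ 0 := by positivity
  unfold Delta
  rw [show 2 * r + 1 = r + (r + 1) by ring, Finset.sum_range_add, Finset.sum_range_succ',
    ← add_assoc]
  congr 1
  · congr 1
    · refine sum_congr rfl fun ν _ => ?_
      congr 2
      push_cast
      field_simp
      ring
    · rw [← Finset.sum_range_reflect]
      refine sum_congr rfl fun ν hν => ?_
      have hν' : ν < r := by simpa using hν
      have e : r + (r - 1 - ν + 1) = 2 * r - ν := by omega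
      rw [e, Nat.choose_symm (by omega : ν ≤ 2 * r)]
      have e2 : (-1 : ℝ) ^ (2 * r - ν) = (-1) ^ ν := by
        have : (-1 : ℝ) ^ (2 * r - ν) * (-1) ^ ν = (-1) ^ ν * (-1) ^ ν := by
          rw [← pow_add, Nat.sub_add_cancel (by omega), pow_mul, ← mul_pow]
          norm_num
        exact mul_right_cancel₀ (pow_ne_zero _ (by norm_num)) this
      rw [e2]
      congr 2
      rw [Nat.cast_sub (by omega)]
      push_cast
      field_simp
      ring
  · simp only [add_zero]
    congr 2
    push_cast
    field_simp
    ring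

lemma steklov_smooth (r s : ℕ) (hr : 1 ≤ r) (hs : 1 ≤ s) (hsr : s ≤ 2 * r) :
    ∃ B : ℝ, 0 < B ∧ ∀ g : ℝ → ℝ, ContDiff ℝ (s : ℕ∞) g → ∀ δ : ℝ, 0 < δ → ∀ x : ℝ,
      |steklov r δ g x - g x| ≤
        (B * δ ^ (s - 1)) * ∫ y in (x - δ / 2)..(x + δ / 2), |iteratedDeriv s g y| := by
  obtain ⟨B, hB, hb⟩ := diff_bound s hs (2 * r) hsr
  refine ⟨B, hB, fun g hg δ hδ x => ?_⟩
  have hr1 : (1 : ℝ) ≤ r := by exact_mod_cast hr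
  have hr0 : (r : ℝ) ≠ 0 := by positivity
  have hgc : Continuous g := hg.continuous
  have hdc : Continuous (iteratedDeriv s g) := hg.continuous_iteratedDeriv s le_rfl
  set I := ∫ y in (x - δ / 2)..(x + δ / 2), |iteratedDeriv s g y| with hI
  have hI0 : 0 ≤ I := intervalIntegral.integral_nonneg (by linarith) fun _ _ => abs_nonneg _
  set S : ℝ → ℝ := fun t => ∑ ν ∈ range r, (-1 : ℝ) ^ ν * (((2 * r).choose ν : ℝ)) *
        g (x + (((r : ℝ) - (ν : ℝ)) / (r : ℝ)) * t) with hS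
  have hSc : Continuous S := by
    rw [hS]
    fun_prop
  set c : ℝ := ((2 * r).choose r : ℝ) with hc
  have hc0 : 0 < c := by
    rw [hc]
    exact_mod_cast Nat.choose_pos (by omega : r ≤ 2 * r)
  set D : ℝ → ℝ := fun t => S t + S (-t) + (-1 : ℝ) ^ r * c * g x with hD
  have hDelta : ∀ t, D t = Delta (2 * r) (t / r) g (x - t) := fun t =>
    (Delta_split r hr g x t).symm
  have hDeven : ∀ t, D (-t) = D t := by
    intro t
    simp only [hD, neg_neg]
    ring
  have hDpos : ∀ t, 0 ≤ t → t ≤ δ / 2 → |D t| ≤ B * δ ^ (s - 1) * I := by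
    intro t ht0 ht1
    rw [hDelta]
    refine (hb g hg (t / r) (by positivity) (x - t)).trans ?_
    have e : x - t + ((2 * r : ℕ) : ℝ) * (t / r) = x + t := by
      push_cast
      field_simp
      ring
    rw [e]
    have h1 : t / r ≤ δ := (div_le_self ht0 hr1).trans (by linarith)
    have h2 := abs_int_mono hdc (a := x - t) (b := x + t) (c := x - δ / 2) (d := x + δ / 2)
      (by linarith) (by linarith) (by linarith)
    have h3 : (0:ℝ) ≤ ∫ y in (x - t)..(x + t), |iteratedDeriv s g y| :=
      intervalIntegral.integral_nonneg (by linarith) fun _ _ => abs_nonneg _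
    have h4 : (t / r) ^ (s - 1) ≤ δ ^ (s - 1) := pow_le_pow_left₀ (by positivity) h1 _
    exact mul_le_mul (mul_le_mul_of_nonneg_left h4 hB.le) h2 h3 (by positivity)
  have hDint : |∫ t in (-(δ / 2))..(δ / 2), D t| ≤ (B * δ ^ (s - 1) * I) * δ := by
    have := intervalIntegral.norm_integral_le_of_norm_le_const (a := -(δ / 2)) (b := δ / 2)
      (f := D) (C := B * δ ^ (s - 1) * I) (by
        intro t ht
        rw [Set.uIoc_of_le (by linarith)] at ht
        rw [Real.norm_eq_abs]
        rcases le_total 0 t with h | h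
        · exact hDpos t h ht.2
        · rw [← hDeven]
          exact hDpos (-t) (by linarith) (by linarith [ht.1]))
    rw [Real.norm_eq_abs] at this
    refine this.trans (le_of_eq ?_)
    rw [show δ / 2 - -(δ / 2) = δ by ring, abs_of_pos hδ]
  have hDval : ∫ t in (-(δ / 2))..(δ / 2), D t =
      2 * (∫ t in (-(δ / 2))..(δ / 2), S t) + δ * ((-1 : ℝ) ^ r * c * g x) := by
    have i1 : IntervalIntegrable S volume (-(δ / 2)) (δ / 2) := hSc.intervalIntegrable _ _
    have i2 : IntervalIntegrable (fun t => S (-t)) volume (-(δ / 2)) (δ / 2) :=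
      (hSc.comp continuous_neg).intervalIntegrable _ _
    have i3 : IntervalIntegrable (fun _ : ℝ => (-1 : ℝ) ^ r * c * g x) volume (-(δ / 2)) (δ / 2) :=
      continuous_const.intervalIntegrable _ _
    have e1 := intervalIntegral.integral_add (i1.add i2) i3
    have e2 := intervalIntegral.integral_add i1 i2
    have e3 : ∫ t in (-(δ / 2))..(δ / 2), S (-t) = ∫ t in (-(δ / 2))..(δ / 2), S t := by
      rw [intervalIntegral.integral_comp_neg, neg_neg]
    have e4 : ∫ t in (-(δ / 2))..(δ / 2), D t = (∫ t in (-(δ / 2))..(δ / 2), (S t + S (-t))) +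
      ∫ t in (-(δ / 2))..(δ / 2), (-1 : ℝ) ^ r * c * g x := e1
    rw [e4, e2, e3, intervalIntegral.integral_const, smul_eq_mul]
    ring
  have hsign : (-1 : ℝ) ^ r * (-1) ^ r = 1 := by
    rw [← mul_pow]
    norm_num
  have key : steklov r δ g x - g x = (-1 : ℝ) ^ (r + 1) * c⁻¹ * (1 / δ) *
      ∫ t in (-(δ / 2))..(δ / 2), D t := by
    rw [hDval]
    have : steklov r δ g x = (-1 : ℝ) ^ (r + 1) * c⁻¹ * (2 / δ) *
      ∫ t in (-(δ / 2))..(δ / 2), S t := rfl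
    rw [this]
    have h2 : (-1 : ℝ) ^ (r + 1) * c⁻¹ * (1 / δ) * (δ * ((-1 : ℝ) ^ r * c * g x)) =
        -(((-1 : ℝ) ^ r * (-1) ^ r) * (c⁻¹ * c) * (1 / δ * δ)) * g x := by
      rw [pow_succ]
      ring
    rw [mul_add, h2, hsign, inv_mul_cancel₀ hc0.ne', one_div_mul_cancel hδ.ne']
    ring
  rw [key, abs_mul, abs_mul, abs_mul, abs_pow, abs_neg, abs_one, one_pow, one_mul,
    abs_of_pos (by positivity : 0 < c⁻¹), abs_of_pos (by positivity : 0 < 1 / δ)]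
  calc c⁻¹ * (1 / δ) * |∫ t in (-(δ / 2))..(δ / 2), D t|
      ≤ 1 * (1 / δ) * ((B * δ ^ (s - 1) * I) * δ) := by
        gcongr
        exact choose_inv_le r
    _ = _ := by field_simp

lemma final_arith (a W B K M P Q E d σ : ℝ) (ha : 0 ≤ a) (hW : 0 ≤ W) (hM0 : 0 ≤ M) (hP : 0 ≤ P)
    (hQ : 0 ≤ Q) (hE : 0 ≤ E) (hσ : 0 ≤ σ) (hM : M = B + K + W) (hD : d ≤ P * E + Q * σ) :
    a * E + B * d + K * d + W * (E + d) ≤ (a + W + M * P + M * Q) * (E + σ) := by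
  have hMd : M * d ≤ M * (P * E + Q * σ) := mul_le_mul_of_nonneg_left hD hM0
  have hMe : M * d = B * d + K * d + W * d := by
    rw [hM]
    ring
  have h5 : 0 ≤ (a + W + M * P) * σ := by positivity
  have h6 : 0 ≤ M * Q * E := by positivity
  linarith

theorem stmt9 (p γ : ℝ) (r s : ℕ) (X : ℕ → ℕ → ℝ) (φ : ℕ → ℕ → ℝ → ℝ)
    (G : ℕ → (ℝ → ℝ) → ℝ → ℝ)
    (hp : 1 ≤ p) (hr : 1 ≤ r) (hs : 1 ≤ s) (hsr : s ≤ 2 * r)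
    (hγ0 : 0 < γ) (hγ1 : γ ≤ 1) (hX : NodesOK γ X) (hGform : SamplingForm p X φ G)
    (K1 : ℝ) (hK1 : 0 < K1) (hc1 : CondC1 p K1 X G) (K2 : ℝ) (hK2 : 0 < K2) (hc1' : CondC1' p K2 X G) (K3 : ℝ) (hK3 : 0 < K3) (hc2' : CondC2' p K3 s G) (K4 : ℝ) (hK4 : 0 < K4) :
    ∃ C : ℝ, 0 < C ∧ ∀ f : ℝ → ℝ, MemLpT p f → CondC4 p K4 s G f →
      (∀ ν : ℕ, 1 ≤ ν → IsTrigPoly ν (G ν f)) → ∀ n : ℕ, 1 ≤ n →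
      ellp p n (X n) (fun x => steklov r (γ / (n : ℝ)) f x - f x) + omegaMod s p f (1 / (n : ℝ)) ≤
        C * (LpNorm p (fun x => f x - G n f x) +
          (1 / (n : ℝ) ^ s) * ∑ ν ∈ Finset.range (n + 1),
            ((ν : ℝ) + 1) ^ (s - 1) *
              LpNorm p (fun x => f x - (if ν = 0 then 0 else G ν f x))) := by
  obtain ⟨B, hB, hst⟩ := steklov_smooth r s hr hs hsr
  obtain ⟨W, hW, hom⟩ := omega_bound hp hs
  set a : ℝ := 2 * (r * 4 ^ r) / γ with ha
  have ha0 : 0 ≤ a := by positivity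
  set M : ℝ := B + K3 / K2 + W with hM
  have hM0 : 0 < M := by positivity
  set P : ℝ := (4 * Real.pi) ^ s with hP
  have hP0 : 0 < P := by positivity
  set Q : ℝ := 8 * (4 * Real.pi) ^ s * 4 ^ s with hQ
  have hQ0 : 0 < Q := by positivity
  refine ⟨a + W + M * P + M * Q, by positivity, fun f hf _ hT n hn => ?_⟩
  have hn1 : (1 : ℝ) ≤ n := by exact_mod_cast hn
  have hn0 : (0 : ℝ) < n := by linarith
  have hG0 : G 0 f = fun _ => 0 := by
    funext x
    rw [hGform.2]
    simp
  set g : ℝ → ℝ := G n f with hg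
  have hgT : IsTrigPoly n g := hT n hn
  have hgm : MemLpT p g := hgT.memLpT hp
  obtain ⟨hdT, -⟩ := bernstein_lp hp hn s hgT
  have hdm : MemLpT p (iteratedDeriv s g) := hdT.memLpT hp
  have hfg : MemLpT p (fun x => f x - g x) := hf.sub hp hgm
  set E := LpNorm p (fun x => f x - g x) with hE
  set N := LpNorm p (iteratedDeriv s g) with hN
  have hE0 : 0 ≤ E := LpNorm_nonneg' _ _
  have hN0 : 0 ≤ N := LpNorm_nonneg' _ _
  have hsum : ∑ ν ∈ Finset.range (n + 1), ((ν : ℝ) + 1) ^ (s - 1) *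
      LpNorm p (fun x => f x - (if ν = 0 then 0 else G ν f x)) =
      ∑ ν ∈ Finset.range (n + 1), ((ν : ℝ) + 1) ^ (s - 1) * LpNorm p (fun x => f x - G ν f x) := by
    refine Finset.sum_congr rfl fun ν _ => ?_
    rcases Nat.eq_zero_or_pos ν with h | h
    · subst h
      simp [hG0]
    · simp [h.ne']
  rw [hsum]
  set Sg := ∑ ν ∈ Finset.range (n + 1), ((ν : ℝ) + 1) ^ (s - 1) *
    LpNorm p (fun x => f x - G ν f x) with hSg
  have hSg0 : 0 ≤ Sg := Finset.sum_nonneg fun ν _ => mul_nonneg (by positivity) (LpNorm_nonneg' _ _)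
  -- bound on the derivative of `g`
  have hD : 1 / (n : ℝ) ^ s * N ≤ P * E + Q * (1 / (n : ℝ) ^ s * Sg) := by
    have h1 := telescoping hp hs hf (fun ν => G ν f) hG0 hT n hn
    have h2 : ∑ ν ∈ Finset.range (n / 2 + 1), ((ν : ℝ) + 1) ^ (s - 1) *
        LpNorm p (fun x => f x - G ν f x) ≤ Sg := by
      refine Finset.sum_le_sum_of_subset_of_nonneg ?_
        fun ν _ _ => mul_nonneg (by positivity) (LpNorm_nonneg' _ _)
      intro ν hν
      simp only [Finset.mem_range] at hν ⊢
      omega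
    have h3 : N ≤ P * (n : ℝ) ^ s * E + Q * Sg :=
      h1.trans (add_le_add_right (mul_le_mul_of_nonneg_left h2 hQ0.le) _)
    have hns : (0 : ℝ) < (n : ℝ) ^ s := by positivity
    calc 1 / (n : ℝ) ^ s * N ≤ 1 / (n : ℝ) ^ s * (P * (n : ℝ) ^ s * E + Q * Sg) := by gcongr
      _ = _ := by field_simp
  -- first part
  have hA1 : ellp p n (X n) (fun x => steklov r (γ / (n : ℝ)) (fun t => f t - g t) x) ≤ a * E := by
    have := ellp_window hp hγ0 hγ1 hX hn hfg
      (A := (2 / (γ / n)) * (r * 4 ^ r)) (by positivity)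
      (fun x => steklov_bound hp hfg r (by positivity) x)
    refine this.trans (le_of_eq ?_)
    rw [ha, hE]
    congr 1
    field_simp
  -- second part
  have hA2 : ellp p n (X n) (fun x => steklov r (γ / (n : ℝ)) g x - g x) ≤
      B * (1 / (n : ℝ) ^ s * N) := by
    have := ellp_window hp hγ0 hγ1 hX hn hdm
      (A := B * (γ / n) ^ (s - 1)) (by positivity)
      (fun x => hst g (hgT.contDiff _) (γ / n) (by positivity) x)
    refine this.trans ?_
    rw [← mul_assoc]
    refine mul_le_mul_of_nonneg_right ?_ hN0
    have h1 : (γ / (n : ℝ)) ^ (s - 1) ≤ (1 / (n : ℝ)) ^ (s - 1) := by gcongr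
    calc B * (γ / (n : ℝ)) ^ (s - 1) / n ≤ B * (1 / (n : ℝ)) ^ (s - 1) / n := by gcongr
      _ = B * ((1 / (n : ℝ)) ^ (s - 1) * (1 / n)) := by ring
      _ = B * (1 / (n : ℝ) ^ s) := by
        rw [← pow_succ, Nat.sub_add_cancel hs, one_div_pow]
  -- third part
  have hA3 : ellp p n (X n) (fun x => f x - g x) ≤ K3 / K2 * (1 / (n : ℝ) ^ s * N) := by
    have h1 := hc1' _ hfg n hn
    have h2 : G n (fun x => f x - g x) = fun x => g x - G n g x := by
      funext x
      rw [hg, hGform.2, hGform.2 n f x, hGform.2 n (G n f) x, ← Finset.sum_sub_distrib]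
      refine Finset.sum_congr rfl fun k _ => ?_
      ring
    rw [h2] at h1
    have h3 := h1.trans (hc2' g ⟨hgT.periodic, hgT.contDiff _⟩ n hn)
    have h4 : K3 / K2 * (1 / (n : ℝ) ^ s * N) = (K3 / (n : ℝ) ^ s * N) / K2 := by ring
    rw [h4, le_div_iff₀ hK2]
    linarith
  have hA : ellp p n (X n) (fun x => steklov r (γ / (n : ℝ)) f x - f x) ≤
      a * E + B * (1 / (n : ℝ) ^ s * N) + K3 / K2 * (1 / (n : ℝ) ^ s * N) := by
    have e : (fun x => steklov r (γ / (n : ℝ)) f x - f x) = fun x =>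
        (steklov r (γ / (n : ℝ)) (fun t => f t - g t) x + (steklov r (γ / (n : ℝ)) g x - g x)) +
          (g x - f x) := by
      funext x
      rw [steklov_sub hp hf hgm]
      ring
    rw [e]
    have h1 := ellp_add_le hp n (X n)
      (fun x => steklov r (γ / (n : ℝ)) (fun t => f t - g t) x + (steklov r (γ / (n : ℝ)) g x - g x))
      (fun x => g x - f x)
    have h2 := ellp_add_le hp n (X n)
      (fun x => steklov r (γ / (n : ℝ)) (fun t => f t - g t) x)
      (fun x => steklov r (γ / (n : ℝ)) g x - g x)
    have h3 := ellp_sub_comm p n (X n) g f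
    linarith
  have hO := hom f g hf hgT.periodic hgT.contDiff hdT.periodic n hn
  refine (add_le_add hA hO).trans ?_
  have hσ0 : 0 ≤ 1 / (n : ℝ) ^ s * Sg := mul_nonneg (by positivity) hSg0
  exact final_arith a W B (K3 / K2) M P Q E _ _ ha0 hW.le hM0.le hP0.le hQ0.le hE0 hσ0 hM hD
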